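/- Let H be a real Hilbert space and F a compact subset of H. Suppose (f_k)_{k≥1} is a pure greedy sequence in F, meaning: with V_0 = {0} and V_n = span{f_1, …, f_n}, for every n ≥ 0 the element f_{n+1} ∈ F satisfies dist(f_{n+1}, V_n) = sup_{f ∈ F} dist(f, V_n). Define the greedy error σ_n(F) = sup_{f ∈ F} dist(f, V_n) and the Kolmogorov n-width d_n(F) = inf { sup_{f ∈ F} dist(f, W) : W a linear subspace of H with dim W ≤ n }. Then for every n ≥ 1, σ_n(F) ≤ (2^{n+1} / √3) · d_n(F). -/

import Mathlib

open Submodule InnerProductSpace in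
/-- The distance to a subspace is realised by the orthogonal projection. -/
theorem infDist_eq_norm_sub_starProjection
    {H : Type*} [NormedAddCommGroup H] [InnerProductSpace ℝ H]
    (W : Submodule ℝ H) [W.HasOrthogonalProjection] (v : H) :
    Metric.infDist v (W : Set H) = ‖v - W.starProjection v‖ := by
  rw [starProjection_minimal, Metric.infDist_eq_iInf]
  simp only [dist_eq_norm]
  rfl

/-- Distances to a fixed subspace are bounded on a compact set by their supremum. -/
theorem infDist_le_sSup_image_of_isCompact
    {H : Type*} [PseudoMetricSpace H] {F : Set H} (hF : IsCompact F) (W : Set H)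
    {g : H} (hg : g ∈ F) :
    Metric.infDist g W ≤ sSup ((fun g => Metric.infDist g W) '' F) :=
  le_csSup (hF.image (Metric.continuous_infDist_pt W)).bddAbove ⟨g, hg, rfl⟩

/-- An orthonormal family cannot be uniformly close to a subspace of smaller dimension: the squared
distances to `W` sum to at least the excess of the cardinality over `dim W`. -/
theorem Orthonormal.card_sub_finrank_le_sum_norm_sub_starProjection_sq
    {H : Type*} [NormedAddCommGroup H] [InnerProductSpace ℝ H] {ι : Type*} [Fintype ι]
    {e : ι → H} (he : Orthonormal ℝ e) (W : Submodule ℝ H) [FiniteDimensional ℝ W] :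
    (Fintype.card ι : ℝ) - Module.finrank ℝ W ≤ ∑ i, ‖e i - W.starProjection (e i)‖ ^ 2 := by
  let b := stdOrthonormalBasis ℝ W
  have hproj (v : H) : ‖W.starProjection v‖ ^ 2 = ∑ k, ‖inner ℝ v (b k : H)‖ ^ 2 := by
    rw [Submodule.starProjection_apply, Submodule.norm_coe,
      ← b.sum_sq_norm_inner_left]
    simp
  have hsplit (i : ι) :
      ‖e i - W.starProjection (e i)‖ ^ 2 = 1 - ∑ k, ‖inner ℝ (e i) (b k : H)‖ ^ 2 := by
    have h := W.norm_sq_eq_add_norm_sq_starProjection (e i)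
    rw [Submodule.starProjection_orthogonal_val, he.norm_eq_one i, hproj] at h
    linarith
  have hbessel : ∑ i, ∑ k, ‖inner ℝ (e i) (b k : H)‖ ^ 2 ≤ Module.finrank ℝ W := by
    rw [Finset.sum_comm]
    calc ∑ k, ∑ i, ‖inner ℝ (e i) (b k : H)‖ ^ 2 ≤ ∑ k, ‖(b k : H)‖ ^ 2 :=
          Finset.sum_le_sum fun k _ => he.sum_inner_products_le (b k : H)
      _ = Module.finrank ℝ W := by
          have h (k) : ‖(b k : H)‖ = 1 := b.norm_eq_one k
          simp [h]
  simp only [hsplit, Finset.sum_sub_distrib, Finset.sum_const, Finset.card_univ, nsmul_eq_mul,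
    mul_one]
  linarith

/-- A nonnegative sequence bounded by a constant plus the sum of its predecessors grows at most
geometrically with ratio two. -/
theorem le_two_pow_mul_of_le_add_sum {a : ℕ → ℝ} {ε : ℝ}
    (h : ∀ j, a j ≤ ε + ∑ i ∈ Finset.range j, a i) (j : ℕ) : a j ≤ 2 ^ j * ε := by
  induction j using Nat.strong_induction_on with
  | _ j ih =>
    have hsum : ∑ i ∈ Finset.range j, a i ≤ (2 ^ j - 1) * ε := by
      calc ∑ i ∈ Finset.range j, a i ≤ ∑ i ∈ Finset.range j, 2 ^ i * ε :=
            Finset.sum_le_sum fun i hi => ih i (Finset.mem_range.1 hi)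
        _ = (2 ^ j - 1) * ε := by
            rw [← Finset.sum_mul, geom_sum_eq (by norm_num)]
            norm_num
    linarith [h j]

open Submodule InnerProductSpace in
/-- The Gram–Schmidt vectors are the residuals of the projections onto the preceding span. -/
theorem starProjection_span_image_Iio_eq_sub_gramSchmidt
    {H : Type*} [NormedAddCommGroup H] [InnerProductSpace ℝ H] (g : ℕ → H) (j : ℕ)
    [(span ℝ (g '' Set.Iio j)).HasOrthogonalProjection] :
    (span ℝ (g '' Set.Iio j)).starProjection (g j) = g j - gramSchmidt ℝ g j := by
  refine eq_starProjection_of_mem_orthogonal ?_ ?_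
  · rw [gramSchmidt_def, sub_sub_cancel, ← span_gramSchmidt_Iio ℝ g j]
    refine sum_mem fun i hi => ?_
    rw [starProjection_singleton]
    exact smul_mem _ _ (subset_span ⟨i, Finset.mem_Iio.1 hi, rfl⟩)
  · rw [sub_sub_cancel, mem_orthogonal]
    intro u hu
    refine span_induction ?_ (by simp) (fun x y _ _ hx hy => by rw [inner_add_left, hx, hy, add_zero])
      (fun c x _ hx => by rw [inner_smul_left, hx, mul_zero]) hu
    rintro _ ⟨i, hi, rfl⟩
    rw [real_inner_comm]
    exact gramSchmidt_inv_triangular ℝ g hi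

open Submodule InnerProductSpace in
/-- If `g` is greedy in the sense that no later `g j` is farther from `span {g 0, …, g (i - 1)}`
than `g i`, and every `g j` is within `ε` of `W`, then the `j`-th Gram–Schmidt vector is within
`2 ^ j * ε` of `W`. -/
theorem norm_gramSchmidt_sub_starProjection_le
    {H : Type*} [NormedAddCommGroup H] [InnerProductSpace ℝ H] (g : ℕ → H)
    (hg : ∀ i j, Metric.infDist (g j) (span ℝ (g '' Set.Iio i) : Set H)
      ≤ ‖gramSchmidt ℝ g i‖)
    (W : Submodule ℝ H) [W.HasOrthogonalProjection] {ε : ℝ}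
    (hε : ∀ j, ‖g j - W.starProjection (g j)‖ ≤ ε) (j : ℕ) :
    ‖gramSchmidt ℝ g j - W.starProjection (gramSchmidt ℝ g j)‖ ≤ 2 ^ j * ε := by
  let q := gramSchmidt ℝ g
  have hcoef (i j : ℕ) : |inner ℝ (q i) (g j) / ‖q i‖ ^ 2| ≤ 1 := by
    have : FiniteDimensional ℝ (span ℝ (g '' Set.Iio i)) :=
      FiniteDimensional.span_of_finite ℝ ((Set.finite_Iio i).image g)
    let V := span ℝ (g '' Set.Iio i)
    have hperp : q i ∈ Vᗮ := by
      have h := V.sub_starProjection_mem_orthogonal (g i)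
      rwa [starProjection_span_image_Iio_eq_sub_gramSchmidt, sub_sub_cancel] at h
    have hinner : inner ℝ (q i) (g j) = inner ℝ (q i) (g j - V.starProjection (g j)) := by
      rw [inner_sub_right, V.inner_left_of_mem_orthogonal (V.starProjection_apply_mem _) hperp,
        sub_zero]
    have hle : |inner ℝ (q i) (g j)| ≤ ‖q i‖ ^ 2 := by
      rw [hinner, sq]
      refine (abs_real_inner_le_norm _ _).trans ?_
      gcongr
      rw [← infDist_eq_norm_sub_starProjection]
      exact hg i j
    rw [abs_div, abs_of_nonneg (sq_nonneg ‖q i‖)]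
    exact div_le_one_of_le₀ hle (sq_nonneg _)
  refine le_two_pow_mul_of_le_add_sum (a := fun j => ‖q j - W.starProjection (q j)‖) (fun j => ?_) j
  have hexp : q j = g j - ∑ i ∈ Finset.range j, (inner ℝ (q i) (g j) / ‖q i‖ ^ 2) • q i := by
    have h := gramSchmidt_def'' ℝ g j
    rw [Nat.Iio_eq_range] at h
    exact eq_sub_of_add_eq h.symm
  have hres : q j - W.starProjection (q j) = (g j - W.starProjection (g j)) -
      ∑ i ∈ Finset.range j,
        (inner ℝ (q i) (g j) / ‖q i‖ ^ 2) • (q i - W.starProjection (q i)) := by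
    conv_lhs => rw [hexp]
    simp only [map_sub, map_sum, map_smul, smul_sub, Finset.sum_sub_distrib]
    abel
  calc ‖q j - W.starProjection (q j)‖
      ≤ ‖g j - W.starProjection (g j)‖ + ‖∑ i ∈ Finset.range j,
        (inner ℝ (q i) (g j) / ‖q i‖ ^ 2) • (q i - W.starProjection (q i))‖ := by
        rw [hres]
        exact norm_sub_le _ _
    _ ≤ ε + ∑ i ∈ Finset.range j, ‖q i - W.starProjection (q i)‖ := by
        refine add_le_add (hε j) (norm_sum_le_of_le _ fun i _ => ?_)
        rw [norm_smul, Real.norm_eq_abs]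
        exact mul_le_of_le_one_left (norm_nonneg _) (hcoef i j)

open Submodule InnerProductSpace in
/-- Quantitative comparison of a greedy sequence with a subspace `W` of dimension at most `n`. -/
theorem norm_gramSchmidt_le_of_finrank_le
    {H : Type*} [NormedAddCommGroup H] [InnerProductSpace ℝ H] (g : ℕ → H)
    (hg : ∀ i j, Metric.infDist (g j) (span ℝ (g '' Set.Iio i) : Set H)
      ≤ ‖gramSchmidt ℝ g i‖)
    (hanti : Antitone fun i => ‖gramSchmidt ℝ g i‖)
    (W : Submodule ℝ H) [FiniteDimensional ℝ W] {n : ℕ} (hW : Module.finrank ℝ W ≤ n) {ε : ℝ}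
    (hε : ∀ j, ‖g j - W.starProjection (g j)‖ ≤ ε) :
    ‖gramSchmidt ℝ g n‖ ≤ 2 ^ (n + 1) / √3 * ε := by
  have hε₀ : 0 ≤ ε := (norm_nonneg _).trans (hε 0)
  let q := gramSchmidt ℝ g
  rcases (norm_nonneg (q n)).eq_or_lt with hzero | hpos
  · change ‖q n‖ ≤ _
    rw [← hzero]
    positivity
  have hle (i : Fin (n + 1)) : ‖q n‖ ≤ ‖q i‖ := hanti (Nat.lt_succ_iff.1 i.2)
  have horth : Orthonormal ℝ fun i : Fin (n + 1) => ‖q i‖⁻¹ • q i := by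
    refine ⟨fun i => ?_, fun i j hij => ?_⟩
    · rw [norm_smul, norm_inv, norm_norm, inv_mul_cancel₀ (hpos.trans_le (hle i)).ne']
    · change inner ℝ _ _ = 0
      rw [inner_smul_left, inner_smul_right,
        gramSchmidt_orthogonal ℝ g (fun h => hij (Fin.ext h)), mul_zero, mul_zero]
  have hdist (i : Fin (n + 1)) :
      ‖‖q i‖⁻¹ • q i - W.starProjection (‖q i‖⁻¹ • q i)‖ ≤ ‖q n‖⁻¹ * (2 ^ (i : ℕ) * ε) := by
    rw [map_smul, ← smul_sub, norm_smul, norm_inv, norm_norm]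
    exact mul_le_mul (inv_anti₀ hpos (hle i))
      (norm_gramSchmidt_sub_starProjection_le g hg W hε i) (norm_nonneg _) (by positivity)
  have hsum : (1 : ℝ) ≤ (‖q n‖⁻¹ * ε) ^ 2 * ((4 ^ (n + 1) - 1) / 3) := by
    have hW' : (Module.finrank ℝ W : ℝ) ≤ n := by exact_mod_cast hW
    calc (1 : ℝ) ≤ (Fintype.card (Fin (n + 1)) : ℝ) - Module.finrank ℝ W := by
          rw [Fintype.card_fin]
          push_cast
          linarith
      _ ≤ _ := horth.card_sub_finrank_le_sum_norm_sub_starProjection_sq W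
      _ ≤ ∑ i : Fin (n + 1), (‖q n‖⁻¹ * ε) ^ 2 * 4 ^ (i : ℕ) := by
          refine Finset.sum_le_sum fun i _ => ?_
          refine (pow_le_pow_left₀ (norm_nonneg _) (hdist i) 2).trans_eq ?_
          rw [show (4 : ℝ) = 2 ^ 2 by norm_num, ← pow_mul]
          ring
      _ = _ := by
          rw [← Finset.mul_sum, Fin.sum_univ_eq_sum_range (fun i => (4 : ℝ) ^ i),
            geom_sum_eq (by norm_num)]
          norm_num
  refine (pow_le_pow_iff_left₀ (norm_nonneg _) (by positivity) two_ne_zero).1 ?_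
  change ‖q n‖ ^ 2 ≤ _
  rw [mul_pow, div_pow, Real.sq_sqrt (by norm_num), ← pow_mul, mul_comm (n + 1), pow_mul]
  rw [mul_pow, inv_pow, mul_assoc, ← div_eq_inv_mul, le_div_iff₀ (by positivity)] at hsum
  nlinarith [sq_nonneg ε]

/-- **Greedy algorithm error bound.**
Let `H` be a real Hilbert space and `F` a compact subset of `H`.  If `(f_k)_{k ≥ 1}` is a
pure greedy sequence in `F` (with `V_0 = {0}`, `V_n = span{f_1, …, f_n}`, and
`dist(f_{n+1}, V_n) = sup_{f ∈ F} dist(f, V_n)` for all `n ≥ 0`), then the greedy error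
`σ_n(F) = sup_{f ∈ F} dist(f, V_n)` and the Kolmogorov `n`-width
`d_n(F) = inf { sup_{f ∈ F} dist(f, W) : W subspace, dim W ≤ n }` satisfy
`σ_n(F) ≤ (2^(n+1) / √3) · d_n(F)` for every `n ≥ 1`. -/
theorem greedy_error_vs_kolmogorov_width
    {H : Type*} [NormedAddCommGroup H] [InnerProductSpace ℝ H] [CompleteSpace H]
    (F : Set H) (hF : IsCompact F) (hFne : F.Nonempty)
    (f : ℕ → H) (hfF : ∀ k, 1 ≤ k → f k ∈ F)
    (V : ℕ → Submodule ℝ H)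
    (hV : ∀ n, V n = Submodule.span ℝ (f '' {k | 1 ≤ k ∧ k ≤ n}))
    (hgreedy : ∀ n : ℕ,
      Metric.infDist (f (n + 1)) (V n : Set H)
        = sSup ((fun g => Metric.infDist g (V n : Set H)) '' F))
    (σ : ℕ → ℝ)
    (hσ : ∀ n, σ n = sSup ((fun g => Metric.infDist g (V n : Set H)) '' F))
    (d : ℕ → ℝ)
    (hd : ∀ n, d n = sInf {r : ℝ | ∃ W : Submodule ℝ H,
      FiniteDimensional ℝ W ∧ Module.finrank ℝ W ≤ n ∧
      r = sSup ((fun g => Metric.infDist g (W : Set H)) '' F)}) :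
    ∀ n : ℕ, 1 ≤ n → σ n ≤ (2 ^ (n + 1) / Real.sqrt 3) * d n := by
  intro n _
  let g : ℕ → H := fun i => f (i + 1)
  have hVg (i : ℕ) : V i = Submodule.span ℝ (g '' Set.Iio i) := by
    rw [hV]
    congr 1
    ext x
    constructor
    · rintro ⟨k, ⟨h₁, h₂⟩, rfl⟩
      exact ⟨k - 1, by simp only [Set.mem_Iio]; omega, by simp only [g]; congr 1; omega⟩
    · rintro ⟨k, hk, rfl⟩
      exact ⟨k + 1, ⟨by omega, hk⟩, rfl⟩
  have hgF (j : ℕ) : g j ∈ F := hfF (j + 1) (by omega)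
  have hσg (i : ℕ) : σ i = ‖InnerProductSpace.gramSchmidt ℝ g i‖ := by
    have : FiniteDimensional ℝ (Submodule.span ℝ (g '' Set.Iio i)) :=
      FiniteDimensional.span_of_finite ℝ ((Set.finite_Iio i).image g)
    rw [hσ, ← hgreedy, hVg, infDist_eq_norm_sub_starProjection]
    change ‖g i - (Submodule.span ℝ (g '' Set.Iio i)).starProjection (g i)‖ = _
    rw [starProjection_span_image_Iio_eq_sub_gramSchmidt, sub_sub_cancel]
  have hσle (i : ℕ) {x : H} (hx : x ∈ F) : Metric.infDist x (V i : Set H) ≤ σ i :=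
    (infDist_le_sSup_image_of_isCompact hF _ hx).trans_eq (hσ i).symm
  have hanti : Antitone σ := by
    intro m k hmk
    rw [hσ k, ← hgreedy]
    refine (Metric.infDist_le_infDist_of_subset ?_ ⟨0, (V m).zero_mem⟩).trans (hσle m (hgF k))
    rw [hVg, hVg]
    exact Submodule.span_mono (Set.image_mono (Set.Iio_subset_Iio hmk))
  have hbound (r : ℝ) (hr : ∃ W : Submodule ℝ H, FiniteDimensional ℝ W ∧
      Module.finrank ℝ W ≤ n ∧ r = sSup ((fun g => Metric.infDist g (W : Set H)) '' F)) :
      σ n ≤ 2 ^ (n + 1) / Real.sqrt 3 * r := by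
    obtain ⟨W, hWfin, hW, rfl⟩ := hr
    rw [hσg]
    refine norm_gramSchmidt_le_of_finrank_le g (fun i j => ?_) ?_ W hW fun j => ?_
    · rw [← hVg, ← hσg]
      exact hσle i (hgF j)
    · simpa only [← hσg] using hanti
    · rw [← infDist_eq_norm_sub_starProjection]
      exact infDist_le_sSup_image_of_isCompact hF _ (hgF j)
  rw [hd, mul_comm, ← div_le_iff₀ (by positivity)]
  refine le_csInf ⟨_, ⊥, inferInstance, by simp, rfl⟩ fun r hr => ?_
  rw [div_le_iff₀ (by positivity), mul_comm]
  exact hbound r hr
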